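/- arXiv:1905.02687 — 7 statements merged into one kernel-verified Lean document; each statement's English description precedes it below -/
import Mathlib

section
/- Let p be a prime, m a positive integer with m ≤ p, and for each index j ∈ {1,…,p} fix an integer k_j with 1 ≤ k_j ≤ p−1. Let Φ be any m×p integer matrix whose entries satisfy φ_{i j} ≡ k_j · j^{i−1} (mod p) for 1 ≤ i ≤ m, 1 ≤ j ≤ p. If x ∈ ℤ^p has at most m nonzero coordinates and Φx = 0 (in ℤ^m), then x = 0. -/
open Polynomial in
/-- A vector with at most `m` nonzero coordinates whose first `m` power moments at distinct nodes
vanish is zero. -/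
theorem eq_zero_of_sum_mul_pow_eq_zero {F ι : Type*} [Field F] [Fintype ι]
    {v : ι → F} (hv : Function.Injective v) {c : ι → F} {S : Finset ι} {m : ℕ}
    (hS : S.card ≤ m) (hc : ∀ j, j ∉ S → c j = 0)
    (h : ∀ i < m, ∑ j, c j * v j ^ i = 0) : c = 0 := by
  classical
  have hpoly : ∀ P : F[X], P.natDegree < m → ∑ j, c j * P.eval (v j) = 0 := by
    intro P hP
    simp_rw [eval_eq_sum_range, Finset.mul_sum]
    rw [Finset.sum_comm]
    refine Finset.sum_eq_zero fun i hi => ?_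
    have him : i < m := by
      have := Finset.mem_range.mp hi
      omega
    calc ∑ j, c j * (P.coeff i * v j ^ i) = P.coeff i * ∑ j, c j * v j ^ i := by
          rw [Finset.mul_sum]
          exact Finset.sum_congr rfl fun j _ => by ring
      _ = 0 := by rw [h i him, mul_zero]
  funext j₀
  by_cases hj₀ : j₀ ∈ S
  · have hdeg : (∏ j ∈ S.erase j₀, (X - C (v j))).natDegree < m := by
      rw [natDegree_finsetProd_X_sub_C_eq_card, Finset.card_erase_of_mem hj₀]
      have := Finset.card_pos.mpr ⟨j₀, hj₀⟩
      omega
    have hsum := hpoly _ hdeg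
    rw [Finset.sum_eq_single j₀] at hsum
    · refine (mul_eq_zero.mp hsum).resolve_right ?_
      rw [eval_prod, ← ne_eq, Finset.prod_ne_zero_iff]
      intro j hj
      simpa [sub_eq_zero] using fun hjj => Finset.ne_of_mem_erase hj (hv hjj).symm
    · intro j _ hj
      by_cases hjS : j ∈ S
      · rw [eval_prod, Finset.prod_eq_zero (Finset.mem_erase.mpr ⟨hj, hjS⟩) (by simp), mul_zero]
      · rw [hc j hjS, zero_mul]
    · simp
  · exact hc j₀ hj₀

/-- If every integer vector in a set is divisible by `p` and the set is stable under dividing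
by `p`, then it contains only the zero vector. -/
theorem eq_zero_of_forall_dvd_of_descent {ι : Type*} {p : ℤ} (hp : 2 ≤ p)
    {V : (ι → ℤ) → Prop} (hdvd : ∀ x, V x → ∀ j, p ∣ x j)
    (hdiv : ∀ y : ι → ℤ, V (fun j => p * y j) → V y) {x : ι → ℤ} (hx : V x) : x = 0 := by
  have hpow : ∀ n : ℕ, ∀ x, V x → ∀ j, p ^ n ∣ x j := by
    intro n
    induction n with
    | zero => simp
    | succ n ih =>
      intro x hx j
      choose y hy using hdvd x hx
      obtain rfl : x = fun j => p * y j := funext hy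
      rw [pow_succ']
      exact mul_dvd_mul_left p (ih y (hdiv y hx) j)
  funext j
  refine Int.eq_zero_of_abs_lt_dvd (hpow (x j).natAbs x hx j) ?_
  calc |x j| = ((x j).natAbs : ℤ) := (Int.natCast_natAbs _).symm
    _ < 2 ^ (x j).natAbs := by exact_mod_cast Nat.lt_two_pow_self
    _ ≤ p ^ (x j).natAbs := by gcongr

/-- If `Φ` is an `m × p` integer matrix whose `(i, j)` entry is congruent to
`k j * j ^ (i - 1)` modulo a prime `p` (with `m ≤ p` and `1 ≤ k j ≤ p - 1`),
then every integer vector with at most `m` nonzero coordinates lying in the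
kernel of `Φ` (over `ℤ`) is zero. Columns are indexed by `j : Fin p`
representing the index `(j : ℕ) + 1 ∈ {1, …, p}`. -/
theorem integer_sparse_kernel_trivial
    (p m : ℕ) (hp : p.Prime) (hm : 0 < m) (hmp : m ≤ p)
    (k : Fin p → ℤ) (hk : ∀ j, 1 ≤ k j ∧ k j ≤ (p : ℤ) - 1)
    (Φ : Matrix (Fin m) (Fin p) ℤ)
    (hΦ : ∀ i j, Φ i j ≡ k j * ((j : ℕ) + 1 : ℤ) ^ (i : ℕ) [ZMOD (p : ℤ)])
    (x : Fin p → ℤ)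
    (hsparse : (Finset.univ.filter fun j => x j ≠ 0).card ≤ m)
    (hker : ∀ i, ∑ j, Φ i j * x j = 0) :
    x = 0 := by
  have : Fact p.Prime := ⟨hp⟩
  have hp0 : (p : ℤ) ≠ 0 := by exact_mod_cast hp.ne_zero
  refine eq_zero_of_forall_dvd_of_descent (p := p) (by exact_mod_cast hp.two_le)
    (V := fun x => (Finset.univ.filter fun j => x j ≠ 0).card ≤ m ∧ ∀ i, ∑ j, Φ i j * x j = 0)
    ?_ ?_ ⟨hsparse, hker⟩
  · rintro x ⟨hsparse, hker⟩ j
    have hinj : Function.Injective fun j : Fin p => ((j : ℕ) : ZMod p) + 1 := by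
      intro a b hab
      have hab' := (ZMod.natCast_eq_natCast_iff' _ _ _).mp (add_right_cancel hab)
      rw [Nat.mod_eq_of_lt a.isLt, Nat.mod_eq_of_lt b.isLt] at hab'
      exact Fin.ext hab'
    have hzero := eq_zero_of_sum_mul_pow_eq_zero hinj
      (c := fun j => (k j : ZMod p) * (x j : ZMod p)) hsparse
      (fun j hj => by
        have : x j = 0 := by simpa using hj
        simp [this])
      (fun i hi => by
        have hi' := congrArg (Int.cast : ℤ → ZMod p) (hker ⟨i, hi⟩)
        push_cast at hi'
        rw [← hi']
        refine Finset.sum_congr rfl fun j _ => ?_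
        rw [(ZMod.intCast_eq_intCast_iff _ _ _).mpr (hΦ ⟨i, hi⟩ j)]
        push_cast
        ring)
    have hk0 : (k j : ZMod p) ≠ 0 := by
      rw [Ne, ZMod.intCast_zmod_eq_zero_iff_dvd]
      intro hdvd
      have := Int.le_of_dvd (by linarith [(hk j).1]) hdvd
      linarith [(hk j).2]
    exact (ZMod.intCast_zmod_eq_zero_iff_dvd _ _).mp
      ((mul_eq_zero.mp (congrFun hzero j)).resolve_left hk0)
  · rintro y ⟨hsparse, hker⟩
    refine ⟨by simpa [hp.ne_zero] using hsparse, fun i => ?_⟩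
    refine (mul_eq_zero.mp ?_).resolve_left hp0
    rw [← hker i, Finset.mul_sum]
    exact Finset.sum_congr rfl fun j _ => by ring
end

section
/- Let p be a prime, m a positive integer with m ≤ p, and for each j ∈ {1,…,p} fix an integer k_j with 1 ≤ k_j ≤ p−1. Let Φ be any m×p integer matrix with φ_{i j} ≡ k_j · j^{i−1} (mod p). If s is a positive integer with 2s ≤ m and x, x′ ∈ ℤ^p each have at most s nonzero coordinates and satisfy Φx = Φx′ (in ℤ^m), then x = x′. In other words, every s-sparse integer vector is uniquely determined by its measurement vector y = Φx. -/
/-- A combination of distinct nodes whose first `m` power moments vanish is trivial,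
provided that at most `m` nodes are involved. -/
theorem eq_zero_of_sum_mul_pow_eq_zero_s1 {ι R : Type*} [CommRing R] [IsDomain R]
    {T : Finset ι} {m : ℕ} (hT : T.card ≤ m) {v a : ι → R} (hv : Set.InjOn v T)
    (h : ∀ i < m, ∑ j ∈ T, a j * v j ^ i = 0) {j : ι} (hj : j ∈ T) : a j = 0 := by
  have hinj : Function.Injective fun l : Fin T.card => v (T.equivFin.symm l) := fun l l' hl =>
    T.equivFin.symm.injective (Subtype.ext (hv (T.equivFin.symm l).2 (T.equivFin.symm l').2 hl))
  have hzero := Matrix.eq_zero_of_forall_pow_sum_mul_pow_eq_zero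
    (v := fun l => a (T.equivFin.symm l)) hinj fun i => by
      rw [T.equivFin.symm.sum_comp fun t : T => a t * v t ^ (i : ℕ),
        T.sum_coe_sort fun t => a t * v t ^ (i : ℕ)]
      exact h i (i.2.trans_le hT)
  simpa using congrFun hzero (T.equivFin ⟨j, hj⟩)

theorem injective_cast_val_add_one (p : ℕ) :
    Function.Injective fun j : Fin p => ((j : ℕ) + 1 : ZMod p) := by
  intro j j' h
  have h' : ((j : ℕ) : ZMod p) = (j' : ℕ) := add_right_cancel h
  rw [ZMod.natCast_eq_natCast_iff] at h'
  exact Fin.ext (h'.eq_of_lt_of_lt j.2 j'.2)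

/-- Every `m`-sparse integer vector in the kernel of a matrix congruent modulo `p` to a
column-scaled Vandermonde matrix is divisible by `p`. -/
theorem dvd_of_sparse_of_sum_mul_eq_zero {p m : ℕ} (hp : p.Prime) {k : Fin p → ℤ}
    (hk : ∀ j, 1 ≤ k j ∧ k j ≤ (p : ℤ) - 1) {Φ : Matrix (Fin m) (Fin p) ℤ}
    (hΦ : ∀ i j, Φ i j ≡ k j * ((j : ℕ) + 1 : ℤ) ^ (i : ℕ) [ZMOD (p : ℤ)])
    {d : Fin p → ℤ} (hd : (Finset.univ.filter fun j => d j ≠ 0).card ≤ m)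
    (hker : ∀ i, ∑ j, Φ i j * d j = 0) (j : Fin p) : (p : ℤ) ∣ d j := by
  have : Fact p.Prime := ⟨hp⟩
  by_cases hj : d j = 0
  · simp [hj]
  have hprod : (k j * d j : ZMod p) = 0 := by
    refine eq_zero_of_sum_mul_pow_eq_zero_s1 (a := fun l => (k l * d l : ZMod p)) hd
      (injective_cast_val_add_one p).injOn (fun i hi => ?_) (by simpa using hj)
    have hcast : ∑ l, (Φ ⟨i, hi⟩ l * d l : ZMod p) = 0 := by
      exact_mod_cast congrArg (Int.cast : ℤ → ZMod p) (hker ⟨i, hi⟩)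
    rw [← hcast]
    refine (Finset.sum_subset (Finset.filter_subset _ _) fun l _ hl => ?_).trans
      (Finset.sum_congr rfl fun l _ => ?_)
    · have hl0 : d l = 0 := by simpa using hl
      simp [hl0]
    · have hΦl := (ZMod.intCast_eq_intCast_iff _ _ p).mpr (hΦ ⟨i, hi⟩ l)
      push_cast at hΦl
      rw [hΦl]
      ring
  have hkj : (k j : ZMod p) ≠ 0 := fun h0 => by
    have := Int.le_of_dvd (by linarith [hk j]) ((ZMod.intCast_zmod_eq_zero_iff_dvd _ p).mp h0)
    linarith [hk j]
  exact (ZMod.intCast_zmod_eq_zero_iff_dvd _ p).mp ((mul_eq_zero.mp hprod).resolve_left hkj)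

/-- Dividing repeatedly by `p` keeps sparse kernel vectors sparse and in the kernel, so their
entries are divisible by every power of `p`. -/
theorem pow_dvd_of_sparse_of_sum_mul_eq_zero {p m : ℕ} (hp : p.Prime) {k : Fin p → ℤ}
    (hk : ∀ j, 1 ≤ k j ∧ k j ≤ (p : ℤ) - 1) {Φ : Matrix (Fin m) (Fin p) ℤ}
    (hΦ : ∀ i j, Φ i j ≡ k j * ((j : ℕ) + 1 : ℤ) ^ (i : ℕ) [ZMOD (p : ℤ)]) (n : ℕ)
    {d : Fin p → ℤ} (hd : (Finset.univ.filter fun j => d j ≠ 0).card ≤ m)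
    (hker : ∀ i, ∑ j, Φ i j * d j = 0) (j : Fin p) : (p : ℤ) ^ n ∣ d j := by
  induction n generalizing d with
  | zero => simp
  | succ n ih =>
    choose e he using dvd_of_sparse_of_sum_mul_eq_zero hp hk hΦ hd hker
    have hp0 : (p : ℤ) ≠ 0 := by exact_mod_cast hp.ne_zero
    rw [he j, pow_succ']
    refine mul_dvd_mul_left _ (ih ?_ fun i => ?_)
    · simpa [he, hp.ne_zero] using hd
    · refine (mul_eq_zero.mp ?_).resolve_left hp0
      rw [← hker i, Finset.mul_sum]
      exact Finset.sum_congr rfl fun l _ => by rw [he l]; ring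


/-- Uniqueness of sparse recovery: with the measurement matrix `Φ` whose
`(i, j)` entry is congruent to `k j * j ^ (i - 1)` modulo a prime `p`
(columns indexed by `j : Fin p` representing `(j : ℕ) + 1 ∈ {1, …, p}`),
any two integer vectors with at most `s` nonzero coordinates (`2s ≤ m ≤ p`)
having the same measurements `Φ x = Φ x'` over `ℤ` must coincide. -/
theorem integer_sparse_recovery_unique
    (p m s : ℕ) (hp : p.Prime) (hm : 0 < m) (hmp : m ≤ p)
    (hs : 0 < s) (hsm : 2 * s ≤ m)
    (k : Fin p → ℤ) (hk : ∀ j, 1 ≤ k j ∧ k j ≤ (p : ℤ) - 1)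
    (Φ : Matrix (Fin m) (Fin p) ℤ)
    (hΦ : ∀ i j, Φ i j ≡ k j * ((j : ℕ) + 1 : ℤ) ^ (i : ℕ) [ZMOD (p : ℤ)])
    (x x' : Fin p → ℤ)
    (hxs : (Finset.univ.filter fun j => x j ≠ 0).card ≤ s)
    (hxs' : (Finset.univ.filter fun j => x' j ≠ 0).card ≤ s)
    (hmeas : ∀ i, ∑ j, Φ i j * x j = ∑ j, Φ i j * x' j) :
    x = x' := by
  have hd : (Finset.univ.filter fun j => (x - x') j ≠ 0).card ≤ m := by
    have hsub : (Finset.univ.filter fun j => (x - x') j ≠ 0) ⊆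
        (Finset.univ.filter fun j => x j ≠ 0) ∪ Finset.univ.filter fun j => x' j ≠ 0 := by
      intro j
      simp only [Finset.mem_union, Finset.mem_filter, Finset.mem_univ, true_and, Pi.sub_apply]
      lia
    have := (Finset.card_le_card hsub).trans (Finset.card_union_le _ _)
    lia
  have hker : ∀ i, ∑ j, Φ i j * (x - x') j = 0 := fun i => by
    simp [mul_sub, Finset.sum_sub_distrib, hmeas i]
  funext j
  have hdvd := pow_dvd_of_sparse_of_sum_mul_eq_zero hp hk hΦ ((x - x') j).natAbs hd hker j
  refine sub_eq_zero.mp (Int.eq_zero_of_abs_lt_dvd hdvd ?_)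
  rw [Int.abs_eq_natAbs]
  exact_mod_cast Nat.lt_pow_self hp.one_lt
end

section
/- Let F be a field, let I ⊆ F be a finite set, let c : I → F, and define the sequence y_l = Σ_{j ∈ I} c_j · j^{l} for l ≥ 0. If a polynomial Q(t) = Σ_{l=0}^{d} q_l t^{l} ∈ F[t] satisfies Σ_{l=0}^{d} q_l · y_{a+l} = 0 for every integer a ≥ 0, then the polynomial ∏_{j ∈ I, c_j ≠ 0} (t − j) divides Q(t). -/
open scoped Classical

/-- Weights on a finite set of points whose power moments all vanish are zero. -/
theorem Finset.eq_zero_of_forall_sum_mul_pow_eq_zero {R : Type*} [CommRing R] [IsDomain R]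
    (I : Finset R) (w : R → R) (h : ∀ a : ℕ, ∑ j ∈ I, w j * j ^ a = 0) :
    ∀ i ∈ I, w i = 0 := by
  intro i hi
  have hP (P : Polynomial R) : ∑ j ∈ I, w j * P.eval j = 0 := by
    simp_rw [Polynomial.eval_eq_sum_range, Finset.mul_sum]
    rw [Finset.sum_comm]
    refine Finset.sum_eq_zero fun a _ => ?_
    simp_rw [mul_left_comm (w _)]
    rw [← Finset.mul_sum, h, mul_zero]
  have key := hP (∏ k ∈ I.erase i, (Polynomial.X - Polynomial.C k))
  rw [Finset.sum_eq_single_of_mem i hi] at key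
  · refine (mul_eq_zero.mp key).resolve_right ?_
    simp only [Polynomial.eval_prod, Polynomial.eval_sub, Polynomial.eval_X, Polynomial.eval_C]
    exact Finset.prod_ne_zero_iff.mpr fun k hk => sub_ne_zero.mpr (Finset.ne_of_mem_erase hk).symm
  · intro j hj hji
    rw [Polynomial.eval_prod, Finset.prod_eq_zero (Finset.mem_erase.mpr ⟨hji, hj⟩) (by simp),
      mul_zero]

/-- If a polynomial `Q = ∑_{l=0}^{d} q_l t ^ l` is a characteristic polynomial
of a linear recursion satisfied by the sequence `y l = ∑_{j ∈ I} c j * j ^ l`,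
i.e. `∑_{l=0}^{d} q_l * y (a + l) = 0` for all `a ≥ 0`, then
`∏_{j ∈ I, c j ≠ 0} (t - j)` divides `Q`. -/
theorem support_polynomial_dvd_char_poly
    (F : Type*) [Field F] (I : Finset F) (c : F → F)
    (y : ℕ → F) (hy : ∀ l : ℕ, y l = ∑ j ∈ I, c j * j ^ l)
    (Q : Polynomial F) (d : ℕ) (hd : Q.natDegree ≤ d)
    (hQ : ∀ a : ℕ, ∑ l ∈ Finset.range (d + 1), Q.coeff l * y (a + l) = 0) :
    (∏ j ∈ I.filter fun j => c j ≠ 0, (Polynomial.X - Polynomial.C j)) ∣ Q := by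
  have hroot : ∀ j ∈ I, c j * Q.eval j = 0 := by
    refine I.eq_zero_of_forall_sum_mul_pow_eq_zero (fun j => c j * Q.eval j) fun a => ?_
    rw [← hQ a]
    simp_rw [hy, Polynomial.eval_eq_sum_range' (Nat.lt_succ_of_le hd), Finset.mul_sum,
      Finset.sum_mul]
    rw [Finset.sum_comm]
    exact Finset.sum_congr rfl fun l _ => Finset.sum_congr rfl fun j _ => by ring
  refine Finset.prod_dvd_of_coprime
    (fun i _ j _ hij => Polynomial.pairwise_coprime_X_sub_C Function.injective_id hij)
    fun j hj => ?_
  obtain ⟨hjI, hcj⟩ := Finset.mem_filter.mp hj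
  exact Polynomial.dvd_iff_isRoot.mpr ((mul_eq_zero.mp (hroot j hjI)).resolve_left hcj)
end

section
/- Let F be a field, let I ⊆ F be a finite set, let c : I → F, and define y_l = Σ_{j ∈ I} c_j · j^{l} for l ≥ 0. Then the monic polynomial of least degree that is a characteristic polynomial of a linear recursion satisfied by (y_l)_{l≥0} is exactly M(t) = ∏_{j ∈ I, c_j ≠ 0} (t − j). In particular, this minimal characteristic polynomial has only simple roots, its degree equals the number of j ∈ I with c_j ≠ 0, and its set of roots is exactly { j ∈ I : c_j ≠ 0 }. -/
open scoped Classical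

theorem sum_coeff_mul_eq_sum_eval {F : Type*} [Field F] (I : Finset F) (c : F → F) (y : ℕ → F)
    (hy : ∀ l : ℕ, y l = ∑ j ∈ I, c j * j ^ l) (Q : Polynomial F) (a : ℕ) :
    ∑ l ∈ Finset.range (Q.natDegree + 1), Q.coeff l * y (a + l) =
      ∑ j ∈ I, c j * Q.eval j * j ^ a := by
  simp only [hy, Finset.mul_sum, Polynomial.eval_eq_sum_range, Finset.sum_mul]
  rw [Finset.sum_comm]
  refine Finset.sum_congr rfl fun j _ => Finset.sum_congr rfl fun l _ => ?_
  ring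

theorem eq_zero_of_sum_mul_pow_eq_zero_s6 {F : Type*} [Field F] (I : Finset F) (d : F → F)
    (h : ∀ a : ℕ, ∑ j ∈ I, d j * j ^ a = 0) {k : F} (hk : k ∈ I) : d k = 0 := by
  have heval (P : Polynomial F) : ∑ j ∈ I, d j * P.eval j = 0 := by
    simp only [Polynomial.eval_eq_sum_range, Finset.mul_sum]
    rw [Finset.sum_comm]
    refine Finset.sum_eq_zero fun a _ => ?_
    calc ∑ j ∈ I, d j * (P.coeff a * j ^ a) = P.coeff a * ∑ j ∈ I, d j * j ^ a := by
          rw [Finset.mul_sum]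
          exact Finset.sum_congr rfl fun j _ => by ring
      _ = 0 := by rw [h, mul_zero]
  have hP := heval (Lagrange.basis I id k)
  rw [Finset.sum_eq_single_of_mem k hk] at hP
  · have hone := Lagrange.eval_basis_self (Set.injOn_id (I : Set F)) hk
    rw [id] at hone
    rwa [hone, mul_one] at hP
  · intro j hj hjk
    have hzero := Lagrange.eval_basis_of_ne (v := id) hjk.symm hj
    rw [id] at hzero
    rw [hzero, mul_zero]

/-- The minimal (monic, least-degree) characteristic polynomial of a linear
recursion satisfied by the sequence `y l = ∑_{j ∈ I} c j * j ^ l` is exactly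
`M t = ∏_{j ∈ I, c j ≠ 0} (t - j)`: `M` is monic, the sequence satisfies the
recursion with characteristic polynomial `M`, every monic characteristic
polynomial `Q` of a recursion satisfied by `y` has degree at least `deg M`
(with equality forcing `Q = M`); moreover `M` is squarefree (simple roots),
its degree is the number of `j ∈ I` with `c j ≠ 0`, and its root set is
exactly `{j ∈ I : c j ≠ 0}`. -/
theorem minimal_char_poly_eq_support_poly
    (F : Type*) [Field F] (I : Finset F) (c : F → F)
    (y : ℕ → F) (hy : ∀ l : ℕ, y l = ∑ j ∈ I, c j * j ^ l)
    (M : Polynomial F)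
    (hM : M = ∏ j ∈ I.filter fun j => c j ≠ 0, (Polynomial.X - Polynomial.C j)) :
    M.Monic ∧
    (∀ a : ℕ, ∑ l ∈ Finset.range (M.natDegree + 1), M.coeff l * y (a + l) = 0) ∧
    (∀ Q : Polynomial F, Q.Monic →
      (∀ a : ℕ, ∑ l ∈ Finset.range (Q.natDegree + 1), Q.coeff l * y (a + l) = 0) →
      M.natDegree ≤ Q.natDegree ∧ (Q.natDegree = M.natDegree → Q = M)) ∧
    Squarefree M ∧
    M.natDegree = (I.filter fun j => c j ≠ 0).card ∧
    M.roots.toFinset = I.filter fun j => c j ≠ 0 := by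
  have hmonic : M.Monic := hM ▸ Polynomial.monic_prod_X_sub_C _ _
  have hroots : M.roots = (I.filter fun j => c j ≠ 0).val := by
    rw [hM, Polynomial.roots_prod_X_sub_C]
  refine ⟨hmonic, fun a => ?_, fun Q hQ hrec => ?_, ?_, ?_, ?_⟩
  · rw [sum_coeff_mul_eq_sum_eval I c y hy]
    refine Finset.sum_eq_zero fun j hj => ?_
    by_cases hc : c j = 0
    · simp [hc]
    · have hroot : j ∈ M.roots := by
        rw [hroots]
        exact Finset.mem_filter.2 ⟨hj, hc⟩
      rw [Polynomial.isRoot_of_mem_roots hroot, mul_zero, zero_mul]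
  · have hdvd : M ∣ Q := by
      rw [hM]
      refine Finset.prod_dvd_of_coprime
        (fun i _ j _ hij => Polynomial.pairwise_coprime_X_sub_C Function.injective_id hij)
        fun j hj => ?_
      obtain ⟨hjI, hc⟩ := Finset.mem_filter.1 hj
      refine Polynomial.dvd_iff_isRoot.2 ((mul_eq_zero.1 ?_).resolve_left hc)
      exact eq_zero_of_sum_mul_pow_eq_zero_s6 I (fun j => c j * Q.eval j)
        (fun a => (sum_coeff_mul_eq_sum_eval I c y hy Q a).symm.trans (hrec a)) hjI
    exact ⟨Polynomial.natDegree_le_of_dvd hdvd hQ.ne_zero, fun hdeg =>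
      Polynomial.eq_of_monic_of_dvd_of_natDegree_le hmonic hQ hdvd hdeg.le⟩
  · rw [hM]
    exact (Polynomial.separable_prod_X_sub_C_iff'.2 fun _ _ _ _ h => h).squarefree
  · rw [hM, Polynomial.natDegree_finsetProd_X_sub_C_eq_card]
  · rw [hroots, Finset.val_toFinset]
end

section
/- Let p be a prime, m ≤ p a positive integer, k_j integers with 1 ≤ k_j ≤ p−1 for j ∈ {1,…,p}, and let Φ be any m×p integer matrix with φ_{i j} ≡ k_j · j^{i−1} (mod p). Let x ∈ ℤ^p have at most m nonzero coordinates and set y = Φx ∈ ℤ^m. Then for every integer γ ≥ 0: p^γ divides every coordinate of y if and only if p^γ divides every coordinate of x. In particular, if x ≠ 0 then the largest power of p dividing all coordinates of y equals the largest power of p dividing all coordinates of x (the paper's claim α = β). -/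
open Polynomial in
/-- A vector with at most `m` nonzero entries whose first `m` moments at distinct nodes vanish
is zero. -/
theorem eq_zero_of_sparse_of_sum_mul_pow_eq_zero {K ι : Type*} [Field K] [Fintype ι]
    {f : ι → K} (hf : Function.Injective f) {m : ℕ} {v : ι → K} {s : Finset ι}
    (hs : s.card ≤ m) (hv : ∀ j, j ∉ s → v j = 0)
    (h : ∀ i < m, ∑ j, v j * f j ^ i = 0) : v = 0 := by
  classical
  funext a
  by_cases ha : a ∈ s
  · set P : K[X] := ∏ j ∈ s.erase a, (X - C (f j)) with hP
    have hdeg : P.natDegree < m := by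
      rw [hP, natDegree_finsetProd_X_sub_C_eq_card]
      exact (Finset.card_erase_lt_of_mem ha).trans_le hs
    have hsum : ∑ j, v j * P.eval (f j) = 0 := by
      simp_rw [eval_eq_sum_range' hdeg, Finset.mul_sum]
      rw [Finset.sum_comm]
      refine Finset.sum_eq_zero fun i hi => ?_
      simp_rw [mul_left_comm (v _), ← Finset.mul_sum]
      rw [h i (Finset.mem_range.mp hi), mul_zero]
    rw [Finset.sum_eq_single_of_mem a (Finset.mem_univ a)] at hsum
    · refine (mul_eq_zero.mp hsum).resolve_right ?_
      rw [hP, eval_prod]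
      refine Finset.prod_ne_zero_iff.mpr ?_
      intro j hj
      simpa [sub_eq_zero] using fun e => (Finset.ne_of_mem_erase hj) (hf e).symm
    · intro j _ hja
      by_cases hj : j ∈ s
      · rw [hP, eval_prod, Finset.prod_eq_zero (Finset.mem_erase.mpr ⟨hja, hj⟩) (by simp),
          mul_zero]
      · rw [hv j hj, zero_mul]
  · exact hv a ha

/-- If every sparse integer vector whose image under `Φ` is divisible by `q` is itself divisible
by `q`, then the same holds for every power of `q`. -/
theorem pow_dvd_of_forall_pow_dvd_mulVec {κ ι : Type*} [Fintype ι] {q : ℤ} (hq : q ≠ 0) {m : ℕ}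
    {Φ : Matrix κ ι ℤ}
    (hΦ : ∀ x : ι → ℤ, (Finset.univ.filter fun j => x j ≠ 0).card ≤ m →
      (∀ i, q ∣ ∑ j, Φ i j * x j) → ∀ j, q ∣ x j)
    (γ : ℕ) (x : ι → ℤ) (hx : (Finset.univ.filter fun j => x j ≠ 0).card ≤ m)
    (h : ∀ i, q ^ γ ∣ ∑ j, Φ i j * x j) (j : ι) : q ^ γ ∣ x j := by
  induction γ generalizing x with
  | zero => simp
  | succ γ ih =>
    choose z hz using hΦ x hx fun i => (dvd_pow_self q γ.succ_ne_zero).trans (h i)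
    rw [hz j, pow_succ']
    refine mul_dvd_mul_left q (ih z ?_ fun i => ?_)
    · simpa [hz, hq] using hx
    · have := h i
      simp_rw [hz, mul_left_comm _ q, ← Finset.mul_sum] at this
      rw [pow_succ'] at this
      exact (mul_dvd_mul_iff_left hq).mp this

/-- The vectors with at most `m` nonzero entries whose measurements vanish modulo `p` vanish
modulo `p`. -/
theorem dvd_of_sparse_of_forall_dvd_sum {p m : ℕ} (hp : p.Prime) {k : Fin p → ℤ}
    (hk : ∀ j, ¬ (p : ℤ) ∣ k j) {Φ : Matrix (Fin m) (Fin p) ℤ}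
    (hΦ : ∀ i j, Φ i j ≡ k j * ((j : ℕ) + 1 : ℤ) ^ (i : ℕ) [ZMOD (p : ℤ)])
    (x : Fin p → ℤ) (hx : (Finset.univ.filter fun j => x j ≠ 0).card ≤ m)
    (h : ∀ i, (p : ℤ) ∣ ∑ j, Φ i j * x j) (j : Fin p) : (p : ℤ) ∣ x j := by
  have := Fact.mk hp
  have hinj : Function.Injective fun j : Fin p => ((j : ℕ) : ZMod p) + 1 := by
    intro a b hab
    have hab' := (ZMod.natCast_eq_natCast_iff' _ _ _).mp (add_right_cancel hab)
    rwa [Nat.mod_eq_of_lt a.2, Nat.mod_eq_of_lt b.2, ← Fin.ext_iff] at hab'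
  have hzero := eq_zero_of_sparse_of_sum_mul_pow_eq_zero hinj
    (v := fun j => (k j : ZMod p) * (x j : ZMod p)) hx
    (fun j hj => by
      have : x j = 0 := by simpa using hj
      simp [this])
    (fun i hi => by
      have hi' := (ZMod.intCast_zmod_eq_zero_iff_dvd _ p).mpr (h ⟨i, hi⟩)
      push_cast at hi'
      rw [← hi']
      refine Finset.sum_congr rfl fun j _ => ?_
      have hij := (ZMod.intCast_eq_intCast_iff _ _ p).mpr (hΦ ⟨i, hi⟩ j)
      push_cast at hij
      rw [hij]
      ring)
  have hj := congrFun hzero j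
  simp only [Pi.zero_apply, mul_eq_zero, ZMod.intCast_zmod_eq_zero_iff_dvd] at hj
  exact hj.resolve_left (hk j)

/-- With the measurement matrix `Φ` (entries congruent to `k j * j ^ (i-1)`
modulo the prime `p`, columns indexed by `j : Fin p` representing
`(j : ℕ) + 1 ∈ {1, …, p}`) and an integer vector `x` with at most `m` nonzero
coordinates, `y = Φ x` satisfies: for every `γ ≥ 0`, `p ^ γ` divides every
coordinate of `y` iff `p ^ γ` divides every coordinate of `x`; in particular,
if `x ≠ 0` the exact power of `p` dividing all coordinates of `y` equals that
dividing all coordinates of `x` (the claim `α = β`). -/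
theorem power_of_p_dividing_measurements
    (p m : ℕ) (hp : p.Prime) (hm : 0 < m) (hmp : m ≤ p)
    (k : Fin p → ℤ) (hk : ∀ j, 1 ≤ k j ∧ k j ≤ (p : ℤ) - 1)
    (Φ : Matrix (Fin m) (Fin p) ℤ)
    (hΦ : ∀ i j, Φ i j ≡ k j * ((j : ℕ) + 1 : ℤ) ^ (i : ℕ) [ZMOD (p : ℤ)])
    (x : Fin p → ℤ)
    (hsparse : (Finset.univ.filter fun j => x j ≠ 0).card ≤ m)
    (y : Fin m → ℤ) (hy : ∀ i, y i = ∑ j, Φ i j * x j) :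
    (∀ γ : ℕ, (∀ i, (p : ℤ) ^ γ ∣ y i) ↔ (∀ j, (p : ℤ) ^ γ ∣ x j)) ∧
    (x ≠ 0 → ∀ α β : ℕ,
      ((∀ i, (p : ℤ) ^ α ∣ y i) ∧ ¬ (∀ i, (p : ℤ) ^ (α + 1) ∣ y i)) →
      ((∀ j, (p : ℤ) ^ β ∣ x j) ∧ ¬ (∀ j, (p : ℤ) ^ (β + 1) ∣ x j)) →
      α = β) := by
  have hk' : ∀ j, ¬ (p : ℤ) ∣ k j := fun j hd => by
    have := Int.le_of_dvd (by linarith [(hk j).1]) hd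
    linarith [(hk j).2]
  have key : ∀ γ : ℕ, (∀ i, (p : ℤ) ^ γ ∣ y i) ↔ (∀ j, (p : ℤ) ^ γ ∣ x j) := by
    refine fun γ => ⟨fun h => ?_, fun h i => ?_⟩
    · exact pow_dvd_of_forall_pow_dvd_mulVec (by exact_mod_cast hp.ne_zero)
        (dvd_of_sparse_of_forall_dvd_sum hp hk' hΦ) γ x hsparse fun i => hy i ▸ h i
    · rw [hy i]
      exact Finset.dvd_sum fun j _ => (h j).mul_left _
  refine ⟨key, ?_⟩
  rintro - α β ⟨hα, hα'⟩ ⟨hβ, hβ'⟩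
  rw [key] at hα hα'
  refine le_antisymm (not_lt.mp fun hlt => ?_) (not_lt.mp fun hlt => ?_)
  · exact hβ' fun j => (pow_dvd_pow _ hlt).trans (hα j)
  · exact hα' fun j => (pow_dvd_pow _ hlt).trans (hβ j)
end

section
/- Let p be an odd prime, κ ≥ 1 an integer, γ_1, …, γ_κ integers with γ_k ≥ 1, G_k = γ_1 + ⋯ + γ_k, let ξ_1, …, ξ_{κ−1} be integers with |ξ_k| ≤ (p−1)/2, let t be a nonzero integer, and let M ≥ 1. If |t · p^{G_κ} + Σ_{k=1}^{κ−1} ξ_k · p^{G_k}| ≤ M, then p^{G_κ} ≤ 2M; in particular p^{κ} ≤ 2M, i.e., κ ≤ log_p(2M). -/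
/-- A sum of balanced base-`p` digits placed at strictly increasing positive exponents
`e 1 < ⋯ < e n` is less than half of `p ^ (e n + 1)` in absolute value. -/
theorem two_mul_abs_sum_balanced_digits_lt {p : ℤ} (hp : 1 ≤ p) (e : ℕ → ℕ) (d : ℕ → ℤ) (n : ℕ)
    (he : ∀ k < n, e k < e (k + 1))
    (hd : ∀ k, 1 ≤ k → k ≤ n → 2 * |d k| ≤ p - 1) :
    2 * |∑ k ∈ Finset.Icc 1 n, d k * p ^ e k| < p ^ (e n + 1) := by
  induction n with
  | zero => simpa using pow_pos (by lia : 0 < p) _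
  | succ n ih =>
    have hsum := ih (fun k hk => he k (by lia)) fun k h1 hk => hd k h1 (by lia)
    have hpow : p ^ (e n + 1) ≤ p ^ e (n + 1) := pow_le_pow_right₀ hp (he n (by lia))
    have hpos : 0 ≤ p ^ e (n + 1) := by positivity
    have hlast := mul_le_mul_of_nonneg_right (hd (n + 1) (by lia) le_rfl) hpos
    rw [Finset.sum_Icc_succ_top (by lia)]
    have habs := abs_add_le (∑ k ∈ Finset.Icc 1 n, d k * p ^ e k) (d (n + 1) * p ^ e (n + 1))
    rw [abs_mul, abs_of_nonneg hpos] at habs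
    rw [pow_succ]
    linarith

/-- Depth bound for the algorithm: for an odd prime `p`, exponents
`G k = γ 1 + ⋯ + γ k` with each `γ k ≥ 1`, balanced digits `|ξ k| ≤ (p - 1)/2`,
a nonzero integer `t` and a real `M ≥ 1`, if
`|t * p ^ (G κ) + ∑_{k=1}^{κ-1} ξ k * p ^ (G k)| ≤ M` then `p ^ (G κ) ≤ 2 M`;
in particular `p ^ κ ≤ 2 M`, i.e. `κ ≤ log_p (2 M)`. -/
theorem padic_depth_bound
    (p : ℕ) (hp : p.Prime) (hodd : Odd p)
    (κ : ℕ) (hκ : 1 ≤ κ)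
    (γ : ℕ → ℕ) (hγ : ∀ k, 1 ≤ k → k ≤ κ → 1 ≤ γ k)
    (G : ℕ → ℕ) (hG : ∀ k, G k = ∑ i ∈ Finset.Icc 1 k, γ i)
    (ξ : ℕ → ℤ) (hξ : ∀ k, 1 ≤ k → k ≤ κ - 1 → |ξ k| ≤ ((p : ℤ) - 1) / 2)
    (t : ℤ) (ht : t ≠ 0)
    (M : ℝ) (hM : 1 ≤ M)
    (hbound :
      |((t * (p : ℤ) ^ (G κ) + ∑ k ∈ Finset.Icc 1 (κ - 1), ξ k * (p : ℤ) ^ (G k) : ℤ) : ℝ)| ≤ M) :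
    (p : ℝ) ^ (G κ) ≤ 2 * M ∧ (p : ℝ) ^ κ ≤ 2 * M ∧
      (κ : ℝ) ≤ Real.logb p (2 * M) := by
  have hp1 : (1 : ℤ) ≤ p := by exact_mod_cast hp.one_le
  have hp1' : (1 : ℝ) < p := by exact_mod_cast hp.one_lt
  have hstep : ∀ k < κ, G k < G (k + 1) := fun k hk => by
    rw [hG k, hG (k + 1), Finset.sum_Icc_succ_top (by lia)]
    have := hγ (k + 1) (by lia) (by lia)
    lia
  have hdepth : κ ≤ G κ := by
    rw [hG]
    simpa using Finset.card_nsmul_le_sum (Finset.Icc 1 κ) γ 1 fun k hk =>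
      hγ k (Finset.mem_Icc.mp hk).1 (Finset.mem_Icc.mp hk).2
  have htail := two_mul_abs_sum_balanced_digits_lt hp1 G ξ (κ - 1)
    (fun k hk => hstep k (by lia)) fun k h1 hk => by have := hξ k h1 hk; lia
  have hlast : (p : ℤ) ^ (G (κ - 1) + 1) ≤ (p : ℤ) ^ G κ := by
    refine pow_le_pow_right₀ hp1 ?_
    have := hstep (κ - 1) (by lia)
    rwa [Nat.sub_add_cancel hκ] at this
  set S := ∑ k ∈ Finset.Icc 1 (κ - 1), ξ k * (p : ℤ) ^ G k
  have hlead : (p : ℤ) ^ G κ ≤ |t * (p : ℤ) ^ G κ| := by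
    have hpos : (0 : ℤ) ≤ (p : ℤ) ^ G κ := by positivity
    rw [abs_mul, abs_of_nonneg hpos]
    exact le_mul_of_one_le_left hpos (Int.one_le_abs ht)
  have hint : (p : ℤ) ^ G κ ≤ 2 * |t * (p : ℤ) ^ G κ + S| := by
    have := abs_sub_abs_le_abs_add (t * (p : ℤ) ^ G κ) S
    linarith
  have hmain : (p : ℝ) ^ G κ ≤ 2 * M := by
    have hreal : (p : ℝ) ^ G κ ≤ 2 * |((t * (p : ℤ) ^ G κ + S : ℤ) : ℝ)| := by
      exact_mod_cast hint
    linarith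
  have hκM : (p : ℝ) ^ κ ≤ 2 * M := (pow_le_pow_right₀ hp1'.le hdepth).trans hmain
  refine ⟨hmain, hκM, ?_⟩
  rw [Real.le_logb_iff_rpow_le hp1' (by linarith), Real.rpow_natCast]
  exact hκM
end

section
/- Let p be a prime and m ≤ p a positive integer. For every integer j with 1 ≤ j ≤ p−1 there exists an integer k with 1 ≤ k ≤ p−1 such that for every i = 0, 1, …, m−1 there is an integer φ_i with φ_i ≡ k · j^{i} (mod p) and |φ_i| ≤ p^{1−1/m}. -/
/-- Multiples of a vector over `ZMod p` come close to zero: if `p ^ m < p * (b + 1) ^ m`, then some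
nonzero multiple of `a` has all its coordinates represented by integers in `[-b, b]`. -/
theorem exists_ne_zero_mul_eq_intCast_abs_le {p m b : ℕ} [Fact p.Prime] (hb : b < p)
    (hcard : p ^ m < p * (b + 1) ^ m) (a : Fin m → ZMod p) :
    ∃ k : ZMod p, k ≠ 0 ∧ ∀ i, ∃ φ : ℤ, (φ : ZMod p) = k * a i ∧ |φ| ≤ b := by
  obtain ⟨⟨k, c⟩, ⟨k', c'⟩, hne, heq⟩ := Fintype.exists_ne_map_eq_of_card_lt
    (fun (x : ZMod p × (Fin m → Fin (b + 1))) (i : Fin m) => x.1 * a i + ((x.2 i : ℕ) : ZMod p))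
    (by simpa [ZMod.card] using hcard)
  have hcoord (i : Fin m) :
      k * a i + ((c i : ℕ) : ZMod p) = k' * a i + ((c' i : ℕ) : ZMod p) := congrFun heq i
  refine ⟨k - k', fun hk => hne ?_, fun i => ⟨(c' i : ℕ) - (c i : ℕ), ?_, ?_⟩⟩
  · obtain rfl := sub_eq_zero.mp hk
    congr 1
    funext i
    have hmod := (ZMod.natCast_eq_natCast_iff' _ _ _).mp (add_left_cancel (hcoord i))
    rw [Nat.mod_eq_of_lt (by omega), Nat.mod_eq_of_lt (by omega)] at hmod
    exact Fin.ext hmod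
  · push_cast
    linear_combination -hcoord i
  · rw [abs_le]
    omega

/-- The construction from [KS]: for a prime `p`, a positive integer `m ≤ p`
and any `j` with `1 ≤ j ≤ p - 1`, there exists a multiplier `k` with
`1 ≤ k ≤ p - 1` such that each residue class `k * j ^ i (mod p)`,
`i = 0, …, m - 1`, has an integer representative `φ` with
`|φ| ≤ p ^ (1 - 1/m)`. -/
theorem exists_small_representatives
    (p m : ℕ) (hp : p.Prime) (hm : 0 < m) (hmp : m ≤ p)
    (j : ℕ) (hj1 : 1 ≤ j) (hj2 : j ≤ p - 1) :
    ∃ k : ℕ, 1 ≤ k ∧ k ≤ p - 1 ∧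
      ∀ i : ℕ, i < m → ∃ φ : ℤ,
        φ ≡ (k : ℤ) * (j : ℤ) ^ i [ZMOD (p : ℤ)] ∧
        (|φ| : ℝ) ≤ (p : ℝ) ^ ((1 : ℝ) - 1 / (m : ℝ)) := by
  have : Fact p.Prime := ⟨hp⟩
  set B : ℝ := (p : ℝ) ^ ((1 : ℝ) - 1 / (m : ℝ)) with hB
  have hp0 : (0 : ℝ) < p := by exact_mod_cast hp.pos
  have hp1 : (1 : ℝ) < p := by exact_mod_cast hp.one_lt
  have hm0 : (0 : ℝ) < m := by exact_mod_cast hm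
  have hB0 : 0 < B := Real.rpow_pos_of_pos hp0 _
  have hBp : B < p := by
    have hexp : (1 : ℝ) - 1 / m < 1 := sub_lt_self 1 (by positivity)
    simpa [hB] using Real.rpow_lt_rpow_of_exponent_lt hp1 hexp
  have hBm : (p : ℝ) * B ^ m = p ^ m := by
    rw [hB, ← Real.rpow_mul_natCast hp0.le, ← Real.rpow_one_add' hp0.le, ← Real.rpow_natCast]
    · congr 1
      field_simp
      ring
    · field_simp
      nlinarith
  have hcard : p ^ m < p * (⌊B⌋₊ + 1) ^ m := by
    have hpow : B ^ m < ((⌊B⌋₊ : ℝ) + 1) ^ m :=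
      pow_lt_pow_left₀ (Nat.lt_floor_add_one B) hB0.le hm.ne'
    have hreal := mul_lt_mul_of_pos_left hpow hp0
    rw [hBm] at hreal
    exact_mod_cast hreal
  obtain ⟨k, hk0, hk⟩ := exists_ne_zero_mul_eq_intCast_abs_le
    ((Nat.floor_lt hB0.le).mpr hBp) hcard (fun i => (j : ZMod p) ^ (i : ℕ))
  refine ⟨k.val, Nat.one_le_iff_ne_zero.mpr ((ZMod.val_ne_zero k).mpr hk0),
    Nat.le_sub_one_of_lt (ZMod.val_lt k), fun i hi => ?_⟩
  obtain ⟨φ, hφ, hφB⟩ := hk ⟨i, hi⟩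
  refine ⟨φ, (ZMod.intCast_eq_intCast_iff _ _ _).mp (by simpa using hφ), ?_⟩
  calc |(φ : ℝ)| ≤ (⌊B⌋₊ : ℝ) := by exact_mod_cast hφB
    _ ≤ B := Nat.floor_le hB0.le
end
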